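/- Let Ω ⊂ ℂⁿ be a domain and let E ⊂ Ω be a closed subset of Ω of Lebesgue measure zero. Let u be a subharmonic function on Ω (viewing Ω ⊂ ℝ^{2n}) which is plurisubharmonic on Ω \ E. Then u is plurisubharmonic on the whole domain Ω. -/

import Mathlib

open MeasureTheory Metric Filter Topology Set
open scoped ENNReal

noncomputable section

/-- Equip `ℂⁿ ≅ ℝ²ⁿ` with its Borel σ-algebra and the Lebesgue measure coming from its real
inner product space structure. -/
instance (n : ℕ) : MeasurableSpace (EuclideanSpace ℂ (Fin n)) := borel _
instance (n : ℕ) : BorelSpace (EuclideanSpace ℂ (Fin n)) := ⟨rfl⟩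


/-- The positive part of an extended real number, as an extended nonnegative real. -/
def erealToENNReal (x : EReal) : ℝ≥0∞ := if x = ⊤ then ⊤ else ENNReal.ofReal x.toReal

variable {E : Type*} [NormedAddCommGroup E] [MeasureSpace E]

/-- The mean value `M_u(x,r)` of an extended-real-valued function `u` over the ball `B(x,r)`,
computed as the difference of the integrals of the positive and negative parts. -/
def erealBallAvg (u : E → EReal) (x : E) (r : ℝ) : EReal :=
  (((∫⁻ y in ball x r, erealToENNReal (u y)) / volume (ball x r) : ℝ≥0∞) : EReal)
    - (((∫⁻ y in ball x r, erealToENNReal (-(u y))) / volume (ball x r) : ℝ≥0∞) : EReal)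

/-- The sub-mean value property on a set `s`: at each point of `s` the value of `u` is at most
its average over every sufficiently small ball centered at the point and contained in `s`. -/
def SubmeanOn (u : E → EReal) (s : Set E) : Prop :=
  ∀ x ∈ s, ∃ R > 0, ∀ r : ℝ, 0 < r → r < R → closedBall x r ⊆ s →
    u x ≤ erealBallAvg u x r

/-- `u : E → [-∞,∞)` is subharmonic on `s` if it is upper semicontinuous on `s`, not
identically `-∞` on `s`, takes values in `[-∞,∞)`, and satisfies the sub-mean value
inequality on `s`. -/
def IsSubharmonicOn (u : E → EReal) (s : Set E) : Prop :=
  UpperSemicontinuousOn u s ∧ (¬ ∀ x ∈ s, u x = ⊥) ∧ (∀ x ∈ s, u x < ⊤) ∧ SubmeanOn u s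

/-- `u` is plurisubharmonic on `s ⊆ ℂⁿ` if it is upper semicontinuous on `s`, not identically
`-∞` on `s`, takes values in `[-∞,∞)`, and its restriction to every complex line satisfies the
sub-mean value inequality (i.e. is subharmonic where defined). -/
def IsPlurisubharmonicOn {n : ℕ} (u : EuclideanSpace ℂ (Fin n) → EReal)
    (s : Set (EuclideanSpace ℂ (Fin n))) : Prop :=
  UpperSemicontinuousOn u s ∧ (¬ ∀ z ∈ s, u z = ⊥) ∧ (∀ z ∈ s, u z < ⊤) ∧
    ∀ a b : EuclideanSpace ℂ (Fin n),
      SubmeanOn (fun w : ℂ => u (a + w • b)) {w : ℂ | a + w • b ∈ s}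

lemma erealToENNReal_eq_toENNReal : erealToENNReal = EReal.toENNReal := by
  ext x
  simp only [erealToENNReal, EReal.toENNReal]

lemma erealBallAvg_mono {V : Type*} [NormedAddCommGroup V] [MeasureSpace V]
    [OpensMeasurableSpace V] {u v : V → EReal} {x : V} {r : ℝ}
    (h : ∀ y ∈ ball x r, u y ≤ v y) : erealBallAvg u x r ≤ erealBallAvg v x r := by
  unfold erealBallAvg
  rw [erealToENNReal_eq_toENNReal]
  refine EReal.sub_le_sub ?_ ?_ <;> rw [EReal.coe_ennreal_le_coe_ennreal_iff] <;>
    refine ENNReal.div_le_div_right (setLIntegral_mono' measurableSet_ball fun y hy => ?_) _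
  · exact EReal.toENNReal_le_toENNReal (h y hy)
  · exact EReal.toENNReal_le_toENNReal (EReal.neg_le_neg_iff.2 (h y hy))

lemma erealBallAvg_coe {V : Type*} [NormedAddCommGroup V] [MeasureSpace V]
    {f : V → ℝ} {x : V} {r : ℝ} (hf : IntegrableOn f (ball x r))
    (hpos : volume (ball x r) ≠ 0) :
    erealBallAvg (fun y => (f y : EReal)) x r = ((⨍ y in ball x r, f y : ℝ) : EReal) := by
  have hP : ∫⁻ y in ball x r, ENNReal.ofReal (f y) ≠ ⊤ := hf.lintegral_lt_top.ne
  have hN : ∫⁻ y in ball x r, ENNReal.ofReal (-f y) ≠ ⊤ := hf.neg.lintegral_lt_top.ne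
  unfold erealBallAvg
  simp only [erealToENNReal_eq_toENNReal, EReal.real_coe_toENNReal, ← EReal.coe_neg]
  rw [setAverage_eq, integral_eq_lintegral_pos_part_sub_lintegral_neg_part hf, smul_sub,
    EReal.coe_sub]
  have key : ∀ A : ℝ≥0∞, A ≠ ⊤ → ((A / volume (ball x r) : ℝ≥0∞) : EReal) =
      (((volume.real (ball x r))⁻¹ • A.toReal : ℝ) : EReal) := fun A hA => by
    rw [← EReal.coe_ennreal_toReal (ENNReal.div_ne_top hA hpos), ENNReal.toReal_div,
      smul_eq_mul, div_eq_inv_mul]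
    rfl
  rw [key _ hP, key _ hN]

lemma le_setAverage_of_le_erealBallAvg {V : Type*} [NormedAddCommGroup V] [MeasureSpace V]
    [OpensMeasurableSpace V] {u : V → EReal} {f : V → ℝ} {x : V} {r c : ℝ}
    (hf : IntegrableOn f (ball x r)) (hpos : volume (ball x r) ≠ 0)
    (h : ∀ y ∈ ball x r, u y ≤ f y) (hc : (c : EReal) ≤ erealBallAvg u x r) :
    c ≤ ⨍ y in ball x r, f y := by
  have := hc.trans (erealBallAvg_mono h)
  rwa [erealBallAvg_coe hf hpos, EReal.coe_le_coe_iff] at this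

/-- Lipschitz regularization (sup-convolution) of an upper semicontinuous function. -/
lemma UpperSemicontinuous.exists_continuous_approx {X : Type*} [MetricSpace X] {v : X → EReal}
    (hv : UpperSemicontinuous v) {M : ℝ} (hM : 0 ≤ M) (hvM : ∀ x, v x ≤ M) :
    ∃ g : ℕ → X → ℝ, (∀ k, Continuous (g k)) ∧ (∀ k x, v x ≤ g k x) ∧ (∀ k x, g k x ≤ M) ∧
      ∀ x (t : ℝ), v x < t → ∀ᶠ k in atTop, g k x ≤ t := by
  have htr : ∀ (k : ℕ) y, (((max (v y) ((-k : ℝ) : EReal)).toReal : ℝ) : EReal) =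
      max (v y) ((-k : ℝ) : EReal) := fun k y => by
    refine EReal.coe_toReal (ne_of_lt (max_lt ?_ (EReal.coe_lt_top _))) (ne_of_gt ?_)
    · exact (hvM y).trans_lt (EReal.coe_lt_top _)
    · exact lt_max_of_lt_right (EReal.bot_lt_coe _)
  set w : ℕ → X → ℝ := fun k y => (max (v y) ((-k : ℝ) : EReal)).toReal with hw
  have hwM : ∀ k y, w k y ≤ M := fun k y => by
    rw [← EReal.coe_le_coe_iff, htr]
    refine max_le (hvM y) (EReal.coe_le_coe_iff.2 ?_)
    have : (0 : ℝ) ≤ k := k.cast_nonneg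
    linarith
  have hle : ∀ (k : ℕ) x y, w k y - k * dist x y ≤ M := fun k x y => by
    have := hwM k y
    have : 0 ≤ (k : ℝ) * dist x y := by positivity
    linarith
  have hbdd : ∀ (k : ℕ) x, BddAbove (range fun y => w k y - k * dist x y) := fun k x =>
    ⟨M, by rintro _ ⟨y, rfl⟩; exact hle k x y⟩
  refine ⟨fun k x => ⨆ y, (w k y - k * dist x y), fun k => ?_, fun k x => ?_, fun k x => ?_,
    fun x t ht => ?_⟩
  · refine LipschitzWith.continuous (K := k) (LipschitzWith.of_le_add_mul _ fun x x' => ?_)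
    have : Nonempty X := ⟨x⟩
    refine ciSup_le fun y => ?_
    have h1 := le_ciSup (hbdd k x') y
    have h2 := mul_le_mul_of_nonneg_left (dist_triangle x' x y) (k.cast_nonneg : (0 : ℝ) ≤ k)
    simp only [NNReal.coe_natCast]
    rw [dist_comm x x']
    linarith
  · have h1 := le_ciSup (hbdd k x) x
    simp only [dist_self, mul_zero, sub_zero] at h1
    calc v x ≤ max (v x) ((-k : ℝ) : EReal) := le_max_left _ _
      _ = w k x := (htr k x).symm
      _ ≤ _ := EReal.coe_le_coe_iff.2 h1
  · have : Nonempty X := ⟨x⟩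
    exact ciSup_le fun y => hle k x y
  · obtain ⟨δ, hδ, hball⟩ := Metric.eventually_nhds_iff.1 (hv x _ ht)
    filter_upwards [eventually_ge_atTop ⌈(M - t) / δ⌉₊, eventually_ge_atTop ⌈-t⌉₊] with k hk1 hk2
    have : Nonempty X := ⟨x⟩
    have hk1 := Nat.ceil_le.1 hk1
    have hk2 := Nat.ceil_le.1 hk2
    rw [div_le_iff₀ hδ] at hk1
    refine ciSup_le fun y => ?_
    by_cases hy : dist y x < δ
    · have h1 : w k y ≤ t := by
        rw [← EReal.coe_le_coe_iff, htr]
        exact max_le (hball hy).le (EReal.coe_le_coe_iff.2 (by linarith))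
      have : 0 ≤ (k : ℝ) * dist x y := by positivity
      linarith
    · have h1 := mul_le_mul_of_nonneg_left (not_lt.1 hy) (k.cast_nonneg : (0 : ℝ) ≤ k)
      rw [dist_comm] at h1
      linarith [hwM k y]

lemma EReal.ofReal_add_toENNReal_neg {M : ℝ} (hM : 0 ≤ M) {t : EReal} (ht : t ≤ M) :
    ENNReal.ofReal M + (-t).toENNReal = ((M : EReal) - t).toENNReal + t.toENNReal := by
  induction t with
  | bot => simp
  | top => simp at ht
  | coe s =>
    have hs : s ≤ M := EReal.coe_le_coe_iff.1 ht
    rw [← EReal.coe_sub, ← EReal.coe_neg]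
    simp only [EReal.real_coe_toENNReal]
    rcases le_total 0 s with h | h
    · rw [ENNReal.ofReal_of_nonpos (by linarith : -s ≤ 0),
        ← ENNReal.ofReal_add (by linarith) h]
      simp
    · rw [ENNReal.ofReal_of_nonpos h, ← ENNReal.ofReal_add hM (by linarith)]
      simp [sub_eq_add_neg]

/-- If the deficit `∫ (M - v)` is small, then the average of `v` is large. -/
lemma le_erealBallAvg_of_lintegral_le {V : Type*} [NormedAddCommGroup V] [MeasureSpace V]
    [OpensMeasurableSpace V] {v : V → EReal} (hv : Measurable v)
    {M c : ℝ} (hM : 0 ≤ M) (hcM : c ≤ M) (hvM : ∀ x, v x ≤ M) {x : V} {r : ℝ}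
    (hpos : volume (ball x r) ≠ 0) (hfin : volume (ball x r) ≠ ⊤)
    (h : ∫⁻ y in ball x r, ((M : EReal) - v y).toENNReal ≤
      ENNReal.ofReal (M - c) * volume (ball x r)) :
    (c : EReal) ≤ erealBallAvg v x r := by
  set P := ∫⁻ y in ball x r, (v y).toENNReal with hP
  set N := ∫⁻ y in ball x r, (-(v y)).toENNReal with hN
  set I := ∫⁻ y in ball x r, ((M : EReal) - v y).toENNReal with hI
  set W := volume (ball x r) with hW
  have hsum : ENNReal.ofReal M * W + N = I + P := by
    rw [← setLIntegral_const, hN, hI, hP, ← lintegral_add_left measurable_const,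
      ← lintegral_add_right _ (by fun_prop)]
    exact lintegral_congr fun y => EReal.ofReal_add_toENNReal_neg hM (hvM y)
  have hPM : P ≤ ENNReal.ofReal M * W := by
    rw [← setLIntegral_const]
    exact lintegral_mono fun y => EReal.toENNReal_le_toENNReal (hvM y)
  have hPf : P ≠ ⊤ := ne_top_of_le_ne_top (ENNReal.mul_ne_top ENNReal.ofReal_ne_top hfin) hPM
  have hIf : I ≠ ⊤ := ne_top_of_le_ne_top (ENNReal.mul_ne_top ENNReal.ofReal_ne_top hfin) h
  have hNf : N ≠ ⊤ := ne_top_of_le_ne_top (ENNReal.add_ne_top.2 ⟨hIf, hPf⟩)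
    (hsum ▸ le_add_self)
  have key : ∀ A : ℝ≥0∞, A ≠ ⊤ → ((A / W : ℝ≥0∞) : EReal) =
      ((A.toReal / W.toReal : ℝ) : EReal) := fun A hA => by
    rw [← EReal.coe_ennreal_toReal (ENNReal.div_ne_top hA hpos), ENNReal.toReal_div]
  unfold erealBallAvg
  rw [erealToENNReal_eq_toENNReal]
  rw [key _ hPf, key _ hNf, ← EReal.coe_sub, EReal.coe_le_coe_iff, ← sub_div,
    le_div_iff₀ (ENNReal.toReal_pos hpos hfin)]
  have e1 := congrArg ENNReal.toReal hsum
  rw [ENNReal.toReal_add (ENNReal.mul_ne_top ENNReal.ofReal_ne_top hfin) hNf,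
    ENNReal.toReal_add hIf hPf, ENNReal.toReal_mul, ENNReal.toReal_ofReal hM] at e1
  have e2 := ENNReal.toReal_mono (ENNReal.mul_ne_top ENNReal.ofReal_ne_top hfin) h
  rw [ENNReal.toReal_mul, ENNReal.toReal_ofReal (by linarith)] at e2
  change c * W.toReal ≤ P.toReal - N.toReal
  nlinarith

lemma UpperSemicontinuousOn.upperSemicontinuous_ite_bot {X : Type*} [TopologicalSpace X]
    {v : X → EReal} {s : Set X} [DecidablePred (· ∈ s)] (hs : IsClosed s)
    (hv : UpperSemicontinuousOn v s) :
    UpperSemicontinuous fun x => if x ∈ s then v x else ⊥ := by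
  intro x t ht
  by_cases hx : x ∈ s
  · simp only [hx, if_true] at ht
    filter_upwards [eventually_nhdsWithin_iff.1 (hv x hx t ht)] with y hy
    by_cases hys : y ∈ s
    · simpa [hys] using hy hys
    · simpa [hys] using bot_le.trans_lt ht
  · filter_upwards [hs.isOpen_compl.mem_nhds hx] with y hy
    have hys : y ∉ s := hy
    simpa [hys] using bot_le.trans_lt ht

/-- An upper semicontinuous function on a closed ball can be approximated from above, in the mean,
by a continuous function. -/
lemma exists_continuous_of_erealBallAvg_lt {V : Type*} [NormedAddCommGroup V] [MeasureSpace V]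
    [BorelSpace V] [ProperSpace V] [(volume : Measure V).IsOpenPosMeasure]
    [IsFiniteMeasureOnCompacts (volume : Measure V)]
    {v : V → EReal} {x : V} {r c : ℝ} (hr : 0 < r)
    (hv : UpperSemicontinuousOn v (closedBall x r)) (hvt : ∀ y ∈ closedBall x r, v y < ⊤)
    (hc : erealBallAvg v x r < c) :
    ∃ g : V → ℝ, Continuous g ∧ (∀ y ∈ closedBall x r, v y ≤ g y) ∧
      ∫ y in ball x r, g y < c * volume.real (ball x r) := by
  classical
  set v' : V → EReal := fun y => if y ∈ closedBall x r then v y else ⊥ with hv'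
  have husc : UpperSemicontinuous v' := hv.upperSemicontinuous_ite_bot isClosed_closedBall
  have hpos : volume (ball x r) ≠ 0 := (measure_ball_pos volume x hr).ne'
  have hfin : volume (ball x r) ≠ ⊤ :=
    ((measure_mono ball_subset_closedBall).trans_lt (isCompact_closedBall x r).measure_lt_top).ne
  obtain ⟨y₀, hy₀, hmax⟩ := hv.exists_isMaxOn ⟨x, mem_closedBall_self hr.le⟩
    (isCompact_closedBall x r)
  set M : ℝ := max (max 0 c) (v y₀).toReal with hM
  have hM0 : 0 ≤ M := (le_max_left _ _).trans (le_max_left _ _)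
  have hcM : c ≤ M := (le_max_right _ _).trans (le_max_left _ _)
  have hvM : ∀ y, v' y ≤ M := fun y => by
    by_cases hy : y ∈ closedBall x r
    · simp only [hv', hy, if_true]
      exact ((hmax hy).trans (EReal.le_coe_toReal (hvt _ hy₀).ne)).trans
        (EReal.coe_le_coe_iff.2 (le_max_right _ _))
    · simp only [hv', hy, if_false]
      exact bot_le
  obtain ⟨g, hgc, hvg, hgM, hgt⟩ := husc.exists_continuous_approx hM0 hvM
  have hint : ∀ k, IntegrableOn (g k) (ball x r) := fun k =>
    ((hgc k).continuousOn.integrableOn_compact (isCompact_closedBall x r)).mono_set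
      ball_subset_closedBall
  by_contra! hcon
  have hge : ∀ k, c * volume.real (ball x r) ≤ ∫ y in ball x r, g k y := fun k =>
    hcon (g k) (hgc k) fun y hy => by simpa [hv', mem_closedBall.1 hy] using hvg k y
  have hI : ∫⁻ y in ball x r, ((M : EReal) - v' y).toENNReal ≤
      ENNReal.ofReal (M - c) * volume (ball x r) := by
    calc ∫⁻ y in ball x r, ((M : EReal) - v' y).toENNReal
        ≤ ∫⁻ y in ball x r, liminf (fun k => ENNReal.ofReal (M - g k y)) atTop := by
          refine lintegral_mono fun y => le_of_forall_lt fun a ha => ?_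
          obtain ⟨b, hab, hb⟩ := exists_between ha
          refine hab.trans_le (le_liminf_of_le (by isBoundedDefault) ?_)
          have hbt : b ≠ ⊤ := hb.ne_top
          have : v' y < ((M - b.toReal : ℝ) : EReal) := by
            rcases eq_or_ne (v' y) ⊥ with h | h
            · rw [h]; exact EReal.bot_lt_coe _
            · have hc : ((v' y).toReal : EReal) = v' y :=
                EReal.coe_toReal ((hvM y).trans_lt (EReal.coe_lt_top _)).ne h
              rw [← hc, ← EReal.coe_sub, EReal.real_coe_toENNReal,
                ENNReal.lt_ofReal_iff_toReal_lt hbt] at hb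
              rw [← hc, EReal.coe_lt_coe_iff]
              linarith
          filter_upwards [hgt y _ this] with k hk
          rw [ENNReal.le_ofReal_iff_toReal_le hbt (by linarith [hgM k y])]
          linarith
      _ ≤ liminf (fun k => ∫⁻ y in ball x r, ENNReal.ofReal (M - g k y)) atTop :=
          lintegral_liminf_le fun k => by have := (hgc k).measurable; fun_prop
      _ ≤ liminf (fun _ : ℕ => ENNReal.ofReal (M - c) * volume (ball x r)) atTop := by
          refine liminf_le_liminf (Eventually.of_forall fun k => ?_)
          have hi₁ : Integrable (fun _ => M) (volume.restrict (ball x r)) := integrableOn_const hfin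
          have hi : Integrable (fun y => M - g k y) (volume.restrict (ball x r)) :=
            hi₁.sub (hint k)
          rw [← ofReal_integral_eq_lintegral_ofReal hi
            (Eventually.of_forall fun y => by simpa using hgM k y),
            integral_sub hi₁ (hint k), setIntegral_const, smul_eq_mul,
            ← ENNReal.ofReal_toReal hfin, ← ENNReal.ofReal_mul (by linarith)]
          refine ENNReal.ofReal_le_ofReal ?_
          have := hge k
          change volume.real (ball x r) * M - _ ≤ (M - c) * volume.real (ball x r)
          linarith
      _ = _ := liminf_const _
  have h1 := le_erealBallAvg_of_lintegral_le husc.measurable hM0 hcM hvM hpos hfin hI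
  refine (h1.trans (erealBallAvg_mono fun y hy => ?_)).not_gt hc
  simp [hv', (mem_ball.1 hy).le]

open Real in
/-- If all circle averages up to radius `r` are at least `c`, so is the average over the disc. -/
lemma mul_volume_ball_le_setIntegral_of_le_circleAverage {g : ℂ → ℝ} (hg : Continuous g)
    {x : ℂ} {r c : ℝ} (h : ∀ s ∈ Ioo 0 r, c ≤ circleAverage g x s) :
    c * volume.real (ball x r) ≤ ∫ y in ball x r, g y := by
  have hcirc : ∀ s : ℝ, ∫ θ in Ioo (-π) π, g (x + s * (Real.cos θ + Real.sin θ * Complex.I)) =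
      2 * π * circleAverage g x s := fun s => by
    rw [circleAverage_eq_integral_add (-π), intervalIntegral.integral_comp_add_right
      (fun θ => g (circleMap x s θ)), intervalIntegral.integral_of_le (by linarith [pi_pos]),
      integral_Ioc_eq_integral_Ioo, smul_eq_mul, ← mul_assoc,
      mul_inv_cancel₀ (by positivity), one_mul]
    have : (0 : ℝ) + -π = -π ∧ 2 * π + -π = π := ⟨by ring, by ring⟩
    rw [this.1, this.2]
    simp [circleMap, Complex.exp_mul_I]
  have hpolar : ∀ f : ℂ → ℝ, Continuous f → ∫ y in ball x r, f y =
      ∫ s in Ioo 0 r, s * ∫ θ in Ioo (-π) π,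
        f (x + s * (Real.cos θ + Real.sin θ * Complex.I)) := fun f hf => by
    have e1 : ∫ y in ball x r, f y = ∫ y, (ball (0 : ℂ) r).indicator (fun y => f (x + y)) y := by
      rw [← integral_indicator measurableSet_ball, ← integral_add_left_eq_self _ x]
      congr 1
      ext y
      simp only [indicator, mem_ball, dist_self_add_left, dist_zero_right]
    rw [e1, ← Complex.integral_comp_polarCoord_symm]
    have e2 : ∀ p ∈ polarCoord.target,
        p.1 • (ball (0 : ℂ) r).indicator (fun y => f (x + y)) (Complex.polarCoord.symm p) =
        (Ioo 0 r ×ˢ Ioo (-π) π).indicator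
          (fun p : ℝ × ℝ => p.1 * f (x + p.1 * (Real.cos p.2 + Real.sin p.2 * Complex.I))) p := by
      rintro ⟨s, θ⟩ ⟨hs, hθ⟩
      have hs' : 0 < s := hs
      have hn : ‖Complex.polarCoord.symm (s, θ)‖ = s := by
        rw [Complex.norm_polarCoord_symm, abs_of_pos hs']
      have hθ' : θ ∈ Ioo (-π) π := hθ
      by_cases hsr : s < r
      · rw [indicator_of_mem (by rwa [mem_ball_zero_iff, hn]), indicator_of_mem (by simp [*])]
        simp [Complex.polarCoord_symm_apply]
      · rw [indicator_of_notMem (by rwa [mem_ball_zero_iff, hn]), indicator_of_notMem (by simp [*])]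
        simp
    rw [setIntegral_congr_fun polarCoord.open_target.measurableSet e2,
      setIntegral_indicator (measurableSet_Ioo.prod measurableSet_Ioo)]
    have e3 : polarCoord.target ∩ Ioo 0 r ×ˢ Ioo (-π) π = Ioo 0 r ×ˢ Ioo (-π) π := by
      refine inter_eq_right.2 (prod_mono (fun s hs => hs.1) subset_rfl)
    rw [e3, Measure.volume_eq_prod, setIntegral_prod]
    · simp only [integral_const_mul]
    · have : Continuous fun p : ℝ × ℝ =>
          p.1 * f (x + p.1 * (Real.cos p.2 + Real.sin p.2 * Complex.I)) := by fun_prop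
      exact (this.continuousOn.integrableOn_compact (isCompact_Icc.prod isCompact_Icc)).mono_set
        (prod_mono Ioo_subset_Icc_self Ioo_subset_Icc_self)
  have hconst : c * volume.real (ball x r) = ∫ _ in ball x r, c := by
    rw [setIntegral_const, smul_eq_mul, mul_comm]
  rw [hconst, hpolar _ continuous_const, hpolar _ hg]
  have hcont : Continuous fun s => circleAverage g x s := by fun_prop
  simp only [hcirc]
  have hi : ∀ f : ℝ → ℝ, Continuous f → IntegrableOn f (Ioo 0 r) := fun f hf =>
    (hf.continuousOn.integrableOn_compact isCompact_Icc).mono_set Ioo_subset_Icc_self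
  refine setIntegral_mono_on (hi _ (by fun_prop)) (hi _ (by fun_prop)) measurableSet_Ioo
    fun s hs => ?_
  refine mul_le_mul_of_nonneg_left ?_ hs.1.le
  rw [setIntegral_const, smul_eq_mul, Real.volume_real_Ioo_of_le (by linarith [pi_pos])]
  have := mul_le_mul_of_nonneg_left (h s hs) two_pi_pos.le
  linarith

open Polynomial in
lemma exists_polynomial_of_mem_span_fourier {T : ℝ} {f : C(AddCircle T, ℂ)}
    (hf : f ∈ Submodule.span ℂ (range (@fourier T))) :
    ∃ P Q : ℂ[X], ∀ y, f y = P.eval (AddCircle.toCircle y : ℂ) +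
      (starRingEnd ℂ) (Q.eval (AddCircle.toCircle y : ℂ)) := by
  have hpow : ∀ (k : ℕ) (y : AddCircle T),
      fourier (k : ℤ) y = (AddCircle.toCircle y : ℂ) ^ k := fun k y => by
    rw [fourier_apply, natCast_zsmul, AddCircle.toCircle_nsmul, Circle.coe_pow]
  induction hf using Submodule.span_induction with
  | mem f hf =>
    obtain ⟨n, rfl⟩ := hf
    obtain ⟨k, rfl | rfl⟩ := n.eq_nat_or_neg
    · exact ⟨X ^ k, 0, fun y => by simp [hpow]⟩
    · exact ⟨0, X ^ k, fun y => by rw [fourier_neg, hpow]; simp⟩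
  | zero => exact ⟨0, 0, fun y => by simp⟩
  | add f g _ _ hf hg =>
    obtain ⟨P, Q, h⟩ := hf
    obtain ⟨P', Q', h'⟩ := hg
    exact ⟨P + P', Q + Q', fun y => by
      rw [ContinuousMap.add_apply, h, h', eval_add, eval_add, map_add]; ring⟩
  | smul a f _ hf =>
    obtain ⟨P, Q, h⟩ := hf
    exact ⟨C a * P, C ((starRingEnd ℂ) a) * Q, fun y => by
      rw [ContinuousMap.smul_apply, h, eval_mul, eval_mul, eval_C, eval_C, map_mul,
        Complex.conj_conj, smul_eq_mul, mul_add]⟩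

open Polynomial Real in
/-- Real parts of polynomials are uniformly dense in the continuous functions on a circle. -/
lemma exists_polynomial_re_near {g : ℂ → ℝ} (hg : Continuous g) (x : ℂ) {s : ℝ} (hs : 0 < s)
    {η : ℝ} (hη : 0 < η) :
    ∃ p : ℂ[X], ∀ w ∈ sphere x s, |(p.eval w).re - g w| < η := by
  have : Fact (0 < 2 * π) := ⟨two_pi_pos⟩
  let F : C(AddCircle (2 * π), ℂ) :=
    ⟨fun y => (g (x + s * (AddCircle.toCircle y : ℂ)) : ℂ), by
      have : Continuous (@AddCircle.toCircle (2 * π)) := AddCircle.continuous_toCircle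
      fun_prop⟩
  have hF : F ∈ (Submodule.span ℂ (range (@fourier (2 * π)))).topologicalClosure := by
    rw [span_fourier_closure_eq_top]; trivial
  obtain ⟨f, hf, hd⟩ := Metric.mem_closure_iff.1 hF η hη
  obtain ⟨P, Q, hPQ⟩ := exists_polynomial_of_mem_span_fourier hf
  refine ⟨(P + Q).comp (C (s : ℂ)⁻¹ * (X - C x)), fun w hw => ?_⟩
  have hsc : (s : ℂ) ≠ 0 := by exact_mod_cast hs.ne'
  obtain ⟨y, hy⟩ : ∃ y : AddCircle (2 * π), w = x + s * (AddCircle.toCircle y : ℂ) := by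
    refine ⟨((Complex.arg (w - x) : ℝ) : AddCircle (2 * π)), ?_⟩
    rw [AddCircle.toCircle_apply_mk, div_self two_pi_pos.ne', one_mul, Circle.coe_exp]
    have h1 := Complex.norm_mul_exp_arg_mul_I (w - x)
    rw [← dist_eq_norm, mem_sphere.1 hw] at h1
    rw [h1]; ring
  have hdy := (ContinuousMap.dist_apply_le_dist (f := F) (g := f) y).trans_lt hd
  rw [dist_comm, dist_eq_norm] at hdy
  refine lt_of_le_of_lt (le_trans (le_of_eq ?_) (Complex.abs_re_le_norm _)) hdy
  have e : (C (s : ℂ)⁻¹ * (X - C x)).eval w = (AddCircle.toCircle y : ℂ) := by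
    rw [hy]; simp [hsc]
  have eF : F y = (g w : ℂ) := by rw [hy]; rfl
  rw [eval_comp, e, hPQ, eF]
  simp

open Polynomial in
lemma circleAverage_polynomial_re (p : ℂ[X]) (x : ℂ) (s : ℝ) :
    Real.circleAverage (fun w => (p.eval w).re) x s = (p.eval x).re := by
  refine InnerProductSpace.HarmonicOnNhd.circleAverage_eq (f := fun w => (p.eval w).re)
    fun w _ => ?_
  exact AnalyticAt.harmonicAt_re (p.differentiable.analyticAt w)

open Polynomial in
/-- If an upper semicontinuous function on a disc violates the sub-mean value inequality, then some
harmonic polynomial separates its value at the center from its values on a circle. -/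
lemma exists_polynomial_of_erealBallAvg_lt {v : ℂ → EReal} {x : ℂ} {r c : ℝ} (hr : 0 < r)
    (hv : UpperSemicontinuousOn v (closedBall x r)) (hvt : ∀ y ∈ closedBall x r, v y < ⊤)
    (hc : erealBallAvg v x r < c) :
    ∃ s ε : ℝ, ∃ p : ℂ[X], 0 < s ∧ s < r ∧ 0 < ε ∧ (p.eval x).re < c ∧
      ∀ w ∈ sphere x s, v w < (((p.eval w).re - ε * s ^ 2 : ℝ) : EReal) := by
  obtain ⟨g, hg, hvg, hgc⟩ := exists_continuous_of_erealBallAvg_lt hr hv hvt hc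
  obtain ⟨s, hs, hsc⟩ : ∃ s ∈ Ioo 0 r, Real.circleAverage g x s < c := by
    by_contra! h
    exact hgc.not_ge (mul_volume_ball_le_setIntegral_of_le_circleAverage hg h)
  set η := (c - Real.circleAverage g x s) / 4 with hη
  have hη0 : 0 < η := by rw [hη]; linarith
  obtain ⟨q, hq⟩ := exists_polynomial_re_near hg x hs.1 hη0
  have hqint : CircleIntegrable (fun w => (q.eval w).re) x s :=
    ContinuousOn.circleIntegrable hs.1.le (Complex.continuous_re.comp q.continuous).continuousOn
  have hgint : CircleIntegrable (fun w => g w + η) x s :=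
    ContinuousOn.circleIntegrable hs.1.le (by fun_prop)
  have hcirc : (q.eval x).re ≤ Real.circleAverage g x s + η := by
    rw [← circleAverage_polynomial_re q x s]
    have e : Real.circleAverage (fun w => g w + η) x s = Real.circleAverage g x s + η := by
      have := Real.circleAverage_fun_add (c := x) (R := s) (f₁ := g) (f₂ := fun _ => η)
        (ContinuousOn.circleIntegrable hs.1.le hg.continuousOn)
        (ContinuousOn.circleIntegrable hs.1.le continuousOn_const)
      rw [Real.circleAverage_const] at this
      exact this
    rw [← e]
    refine Real.circleAverage_mono hqint hgint fun w hw => ?_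
    rw [abs_of_pos hs.1] at hw
    linarith [(abs_lt.1 (hq w hw)).2]
  have hs2 : 0 < s ^ 2 := pow_pos hs.1 2
  refine ⟨s, η / (2 * s ^ 2), q + C ((2 * η : ℝ) : ℂ), hs.1, hs.2, by positivity, ?_,
    fun w hw => ?_⟩
  · rw [eval_add, eval_C, Complex.add_re, Complex.ofReal_re]
    linarith
  · refine (hvg w (sphere_subset_closedBall.trans (closedBall_subset_closedBall hs.2.le) hw)).trans_lt
      (EReal.coe_lt_coe_iff.2 ?_)
    rw [eval_add, eval_C, Complex.add_re, Complex.ofReal_re]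
    have : η / (2 * s ^ 2) * s ^ 2 = η / 2 := by
      have := hs.1.ne'
      field_simp
    rw [this]
    linarith [(abs_lt.1 (hq w hw)).1]

section Contact

variable {V : Type*} [NormedAddCommGroup V]

lemma setIntegral_ball_eq_zero_of_odd [MeasureSpace V] [BorelSpace V]
    [ProperSpace V] [(volume : Measure V).IsAddHaarMeasure]
    {f : V → ℝ} (hf : ∀ y, f (-y) = -f y) (x : V) (r : ℝ) :
    ∫ y in ball x r, f (y - x) = 0 := by
  rw [← integral_indicator measurableSet_ball]
  have h := integral_sub_left_eq_self ((ball x r).indicator fun y => f (y - x)) volume (x + x)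
  have e : ∀ y, (ball x r).indicator (fun y => f (y - x)) (x + x - y) =
      -(ball x r).indicator (fun y => f (y - x)) y := fun y => by
    have h1 : x + x - y - x = -(y - x) := by abel
    have h2 : x + x - y ∈ ball x r ↔ y ∈ ball x r := by
      rw [mem_ball_iff_norm, mem_ball_iff_norm, h1, norm_neg]
    by_cases hy : y ∈ ball x r
    · rw [indicator_of_mem (h2.2 hy), indicator_of_mem hy, h1, hf]
    · rw [indicator_of_notMem (mt h2.1 hy), indicator_of_notMem hy, neg_zero]
  simp only [e, integral_neg] at h
  linarith

lemma measure_image_snd_eq_zero_of_norm_sub_le [NormedSpace ℝ V] [FiniteDimensional ℝ V]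
    [MeasurableSpace V] [BorelSpace V] (μ : Measure V) [μ.IsAddHaarMeasure] {S : Set (V × V)}
    {C : ℝ} (hS : ∀ a ∈ S, ∀ b ∈ S, ‖a.2 - b.2‖ ≤ C * ‖a.1 - b.1‖)
    (h0 : μ (Prod.fst '' S) = 0) : μ (Prod.snd '' S) = 0 := by
  classical
  have hch : ∀ x ∈ Prod.fst '' S, ∃ p, (x, p) ∈ S := by
    rintro _ ⟨⟨x, p⟩, h, rfl⟩
    exact ⟨p, h⟩
  choose! f hf using hch
  have huniq : ∀ a ∈ S, f a.1 = a.2 := fun a ha => by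
    have := hS _ (hf a.1 (mem_image_of_mem _ ha)) _ ha
    rw [sub_self, norm_zero, mul_zero] at this
    exact sub_eq_zero.1 (norm_le_zero_iff.1 this)
  have himg : Prod.snd '' S = f '' (Prod.fst '' S) := by
    rw [image_image]
    exact image_congr fun a ha => (huniq a ha).symm
  have hlip : LipschitzOnWith C.toNNReal f (Prod.fst '' S) := by
    refine LipschitzOnWith.of_dist_le_mul ?_
    rintro _ ⟨a, ha, rfl⟩ _ ⟨b, hb, rfl⟩
    rw [huniq a ha, huniq b hb, dist_eq_norm, dist_eq_norm]
    exact (hS a ha b hb).trans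
      (mul_le_mul_of_nonneg_right (Real.le_coe_toNNReal C) (norm_nonneg _))
  let ν : Measure V := Measure.hausdorffMeasure (Module.finrank ℝ V)
  have : ν.IsAddHaarMeasure := isAddHaarMeasure_hausdorffMeasure
  have h1 : ν (Prod.fst '' S) = 0 := by
    rw [Measure.isAddLeftInvariant_eq_smul ν μ]
    simp [h0]
  have h2 : ν (f '' (Prod.fst '' S)) = 0 := by
    have := hlip.hausdorffMeasure_image_le (Nat.cast_nonneg (Module.finrank ℝ V))
    change ν _ ≤ _ * ν _ at this
    rwa [h1, mul_zero, nonpos_iff_eq_zero] at this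
  rw [himg, Measure.isAddLeftInvariant_eq_smul μ ν]
  simp [h2]

lemma ContDiff.exists_quadratic_bound [NormedSpace ℝ V] {φ : V → ℝ} (hφ : ContDiff ℝ 2 φ)
    (x : V) : ∃ (a : V →L[ℝ] ℝ) (M R : ℝ), 0 < R ∧
      ∀ y ∈ ball x R, φ y ≤ φ x + a (y - x) + M * ‖y - x‖ ^ 2 := by
  have hd : ContDiff ℝ 1 (fderiv ℝ φ) := hφ.fderiv_right (by norm_num)
  obtain ⟨L, t, ht, hL⟩ := hd.contDiffAt.exists_lipschitzOnWith (x := x)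
  obtain ⟨R, hR, hRt⟩ := Metric.mem_nhds_iff.1 ht
  refine ⟨fderiv ℝ φ x, L, R, hR, fun y hy => ?_⟩
  have hsub : closedBall x ‖y - x‖ ⊆ t := fun z hz => hRt <| by
    rw [mem_ball, dist_eq_norm] at hy
    exact (mem_closedBall.1 hz).trans_lt hy
  have h := Convex.norm_image_sub_le_of_norm_hasFDerivWithin_le' (f := φ) (f' := fderiv ℝ φ)
    (φ := fderiv ℝ φ x) (C := L * ‖y - x‖) (s := closedBall x ‖y - x‖) (x := x) (y := y)
    (fun z _ => ((hφ.differentiable (by norm_num)) z).hasFDerivAt.hasFDerivWithinAt)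
    (fun z hz => (hL.norm_sub_le (hsub hz) (mem_of_mem_nhds ht)).trans
      (mul_le_mul_of_nonneg_left (by simpa [dist_eq_norm] using hz) L.2))
    (convex_closedBall _ _) (mem_closedBall_self (norm_nonneg _)) (by simp [dist_eq_norm])
  have := (le_abs_self _).trans h
  rw [pow_two, ← mul_assoc]
  linarith

/-- `u` is touched from above at `x`, within `K`, by the function `φ` plus an affine function of
slope `p`. -/
def IsContact [InnerProductSpace ℝ V] (u : V → EReal) (φ : V → ℝ) (K : Set V) (x p : V) : Prop :=
  ∃ t : ℝ, u x = t ∧ ∀ y ∈ K, u y ≤ ((t + φ y - φ x + inner ℝ p (y - x) : ℝ) : EReal)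

variable [InnerProductSpace ℝ V] [FiniteDimensional ℝ V] [MeasureSpace V] [BorelSpace V]
  [(volume : Measure V).IsAddHaarMeasure]

/-- The slopes at nearby contact points are close to each other. -/
lemma IsContact.norm_sub_le {u : V → EReal} {φ : V → ℝ} {K : Set V} {x₁ x₂ p₁ p₂ : V}
    (h₁ : IsContact u φ K x₁ p₁) (h₂ : IsContact u φ K x₂ p₂) {d : ℝ} (hd : 0 < d)
    (hdx : ‖x₁ - x₂‖ ≤ d) (hK : ball x₁ (2 * d) ⊆ K) {a : V →L[ℝ] ℝ} {M : ℝ} (hM : 0 ≤ M)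
    (hφ : ∀ y ∈ ball x₁ (2 * d), φ y ≤ φ x₁ + a (y - x₁) + M * ‖y - x₁‖ ^ 2)
    (hu : u x₁ ≤ erealBallAvg u x₁ (2 * d)) :
    ‖p₁ - p₂‖ ≤ 16 * M * 8 ^ (Module.finrank ℝ V) * d := by
  have : ProperSpace V := FiniteDimensional.proper ℝ V
  obtain ⟨t₁, ht₁, hc₁⟩ := h₁
  obtain ⟨t₂, ht₂, hc₂⟩ := h₂
  set q := p₁ - p₂ with hq
  rcases eq_or_ne q 0 with hq0 | hq0
  · rw [hq0, norm_zero]; positivity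
  have hqn : 0 < ‖q‖ := norm_pos_iff.2 hq0
  set z := x₁ + (3 / 2 * d / ‖q‖) • q with hz
  have hzx : ‖z - x₁‖ = 3 / 2 * d := by
    rw [hz, add_sub_cancel_left, norm_smul, Real.norm_of_nonneg (by positivity)]
    field_simp
  set B := ball x₁ (2 * d) with hB
  set B' := ball z (d / 4) with hB'
  have hBB : B' ⊆ B := by
    refine ball_subset_ball' ?_
    rw [dist_eq_norm, hzx]; linarith
  have hx₂ : x₂ ∈ B := by
    rw [hB, mem_ball_iff_norm, norm_sub_rev]; linarith
  have ht₂₁ : t₂ ≤ t₁ + φ x₂ - φ x₁ + inner ℝ p₁ (x₂ - x₁) := by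
    have := hc₁ x₂ (hK hx₂)
    rwa [ht₂, EReal.coe_le_coe_iff] at this
  let l : V →L[ℝ] ℝ := a + innerSL ℝ p₁
  have hl : ∀ y, l y = a y + inner ℝ p₁ y := fun y => rfl
  have hpos : volume B ≠ 0 := (measure_ball_pos volume x₁ (by linarith)).ne'
  have hfin : volume B ≠ ⊤ := measure_ball_lt_top.ne
  have hint₁ : IntegrableOn (fun _ : V => t₁ + 4 * M * d ^ 2) B := integrableOn_const hfin
  have hint₂ : IntegrableOn (fun y => l (y - x₁)) B := by
    have : Continuous fun y => l (y - x₁) := by fun_prop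
    exact (this.continuousOn.integrableOn_compact (isCompact_closedBall x₁ (2 * d))).mono_set
      ball_subset_closedBall
  have hint₃ : IntegrableOn (B'.indicator fun _ => ‖q‖ * d / 4) B :=
    (integrableOn_const hfin).indicator measurableSet_ball
  have havg := le_setAverage_of_le_erealBallAvg ((hint₁.add hint₂).sub hint₃) hpos
    (u := u) (c := t₁) (fun y hy => ?_) (ht₁ ▸ hu)
  · rw [setAverage_eq] at havg
    rw [← hB, integral_sub' (hint₁.add hint₂) hint₃, integral_add' hint₁ hint₂, hB,
      setIntegral_ball_eq_zero_of_odd (fun y => map_neg l y), ← hB, setIntegral_indicator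
      measurableSet_ball, inter_eq_right.2 hBB, setIntegral_const, setIntegral_const] at havg
    have hvol : volume.real B = 8 ^ (Module.finrank ℝ V) * volume.real B' := by
      have : (2 * d) = 8 * (d / 4) := by ring
      rw [hB, hB', this, Measure.real, Measure.real,
        Measure.addHaar_ball_mul_of_pos _ _ (by norm_num : (0 : ℝ) < 8),
        ENNReal.toReal_mul, ENNReal.toReal_ofReal (by positivity),
        Measure.addHaar_ball_center volume z]
    have hB'pos : 0 < volume.real B' :=
      ENNReal.toReal_pos (measure_ball_pos volume z (by linarith)).ne' measure_ball_lt_top.ne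
    have h8 : (0 : ℝ) < 8 ^ (Module.finrank ℝ V) := by positivity
    have hBpos : 0 < volume.real B := by rw [hvol]; positivity
    simp only [smul_eq_mul, add_zero] at havg
    rw [← div_eq_inv_mul, le_div_iff₀ hBpos, hvol] at havg
    have h1 : volume.real B' * (d * ‖q‖) ≤
        volume.real B' * (d * (16 * M * 8 ^ (Module.finrank ℝ V) * d)) := by
      nlinarith
    exact le_of_mul_le_mul_left (le_of_mul_le_mul_left h1 hB'pos) hd
  · have hφy := hφ y hy
    have hyn : ‖y - x₁‖ ≤ 2 * d := (mem_ball_iff_norm.1 hy).le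
    have hsq : M * ‖y - x₁‖ ^ 2 ≤ 4 * M * d ^ 2 := by
      have : ‖y - x₁‖ ^ 2 ≤ (2 * d) ^ 2 := pow_le_pow_left₀ (norm_nonneg _) hyn 2
      nlinarith
    by_cases hy' : y ∈ B'
    · refine (hc₂ y (hK hy)).trans (EReal.coe_le_coe_iff.2 ?_)
      simp only [Pi.add_apply, Pi.sub_apply, indicator_of_mem hy', hl]
      have hgap : ‖q‖ * d / 4 ≤ inner ℝ q (y - x₂) := by
        have e : y - x₂ = (x₁ - x₂) + (3 / 2 * d / ‖q‖) • q + (y - z) := by rw [hz]; abel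
        rw [e, inner_add_right, inner_add_right, inner_smul_right, real_inner_self_eq_norm_sq]
        have i1 := (abs_le.1 (abs_real_inner_le_norm q (x₁ - x₂))).1
        have i2 := (abs_le.1 (abs_real_inner_le_norm q (y - z))).1
        have j1 := mul_le_mul_of_nonneg_left hdx hqn.le
        have j2 := mul_le_mul_of_nonneg_left (mem_ball_iff_norm.1 hy').le hqn.le
        have e3 : 3 / 2 * d / ‖q‖ * ‖q‖ ^ 2 = 3 / 2 * d * ‖q‖ := by field_simp
        rw [e3]
        linarith
      have e2 : inner ℝ q (y - x₂) =
          inner ℝ p₁ (y - x₁) - inner ℝ p₁ (x₂ - x₁) - inner ℝ p₂ (y - x₂) := by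
        rw [hq, inner_sub_left, ← inner_sub_right, sub_sub_sub_cancel_right]
      linarith
    · refine (hc₁ y (hK hy)).trans (EReal.coe_le_coe_iff.2 ?_)
      simp only [Pi.add_apply, Pi.sub_apply, indicator_of_notMem hy', hl]
      linarith

/-- An Alexandrov-Bakelman-Pucci type principle: the contact points whose slopes range over a set of
positive measure cannot all lie in a null set. -/
lemma exists_isContact_notMem_of_measure_eq_zero {u : V → EReal} {φ : V → ℝ} {K s N B : Set V}
    (hu : SubmeanOn u s) (hφ : ContDiff ℝ 2 φ) (hKs : K ⊆ s) (hN : volume N = 0)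
    (hB : volume B ≠ 0) (hcontact : ∀ p ∈ B, ∃ x, K ∈ 𝓝 x ∧ IsContact u φ K x p) :
    ∃ p x, K ∈ 𝓝 x ∧ IsContact u φ K x p ∧ x ∉ N := by
  by_contra! hcon
  set G : ℕ → Set V := fun k => {x | (∀ r, 0 < r → r < 1 / ((k : ℝ) + 1) →
    closedBall x r ⊆ K ∧ u x ≤ erealBallAvg u x r) ∧ ∃ a : V →L[ℝ] ℝ,
      ∀ y ∈ ball x (1 / ((k : ℝ) + 1)), φ y ≤ φ x + a (y - x) + k * ‖y - x‖ ^ 2} with hG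
  have hGex : ∀ x, K ∈ 𝓝 x → ∃ k, x ∈ G k := fun x hx => by
    obtain ⟨R₁, hR₁, hK⟩ := Metric.mem_nhds_iff.1 hx
    obtain ⟨R₂, hR₂, hsub⟩ := hu x (hKs (mem_of_mem_nhds hx))
    obtain ⟨a, M, R₃, hR₃, hM⟩ := hφ.exists_quadratic_bound x
    obtain ⟨k₀, hk₀⟩ := exists_nat_one_div_lt (lt_min hR₁ (lt_min hR₂ hR₃))
    obtain ⟨k₁, hk₁⟩ := exists_nat_ge M
    have hle : 1 / (((max k₀ k₁ : ℕ) : ℝ) + 1) ≤ 1 / ((k₀ : ℝ) + 1) := by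
      refine one_div_le_one_div_of_le (by positivity) ?_
      have : (k₀ : ℝ) ≤ (max k₀ k₁ : ℕ) := by exact_mod_cast le_max_left _ _
      linarith
    have hk := hle.trans_lt hk₀
    rw [lt_min_iff, lt_min_iff] at hk
    refine ⟨max k₀ k₁, fun r hr hrk => ?_, a, fun y hy => ?_⟩
    · have hrK : closedBall x r ⊆ K :=
        (closedBall_subset_ball (hrk.trans hk.1)).trans hK
      exact ⟨hrK, hsub r hr (hrk.trans hk.2.1) (hrK.trans hKs)⟩
    · refine (hM y (ball_subset_ball hk.2.2.le hy)).trans ?_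
      have : M ≤ (max k₀ k₁ : ℕ) := hk₁.trans (by exact_mod_cast le_max_right _ _)
      gcongr
  set S : ℕ × ℕ → Set (V × V) := fun i => {a | a.1 ∈ N ∧ a.1 ∈ G i.1 ∧
    a.1 ∈ ball (TopologicalSpace.denseSeq V i.2) (1 / (4 * ((i.1 : ℝ) + 1))) ∧
    IsContact u φ K a.1 a.2} with hS
  have hcover : B ⊆ ⋃ i, Prod.snd '' S i := fun p hp => by
    obtain ⟨x, hxK, hx⟩ := hcontact p hp
    obtain ⟨k, hk⟩ := hGex x hxK
    obtain ⟨j, hj⟩ := (TopologicalSpace.denseRange_denseSeq V).exists_dist_lt x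
      (by positivity : 0 < 1 / (4 * ((k : ℝ) + 1)))
    exact mem_iUnion.2 ⟨(k, j), (x, p), ⟨hcon p x hxK hx, hk, hj, hx⟩, rfl⟩
  refine hB (measure_mono_null hcover (measure_iUnion_null fun i => ?_))
  obtain ⟨k, j⟩ := i
  refine measure_image_snd_eq_zero_of_norm_sub_le volume
    (C := 16 * k * 8 ^ (Module.finrank ℝ V)) ?_ (measure_mono_null ?_ hN)
  · rintro ⟨x₁, p₁⟩ ⟨-, ⟨hG₁, a, ha⟩, hx₁, hc₁⟩ ⟨x₂, p₂⟩ ⟨-, -, hx₂, hc₂⟩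
    have hk : (0 : ℝ) < k + 1 := by positivity
    have hdist : ‖x₁ - x₂‖ < 1 / (2 * ((k : ℝ) + 1)) := by
      rw [← dist_eq_norm]
      refine (dist_triangle_right x₁ x₂ (TopologicalSpace.denseSeq V j)).trans_lt
        ((add_lt_add hx₁ hx₂).trans_eq ?_)
      field_simp; norm_num
    refine ge_of_tendsto (x := 𝓝[>] ‖x₁ - x₂‖)
      (f := fun d => 16 * (k : ℝ) * 8 ^ (Module.finrank ℝ V) * d)
      (Continuous.tendsto' (by fun_prop) _ _ rfl |>.mono_left nhdsWithin_le_nhds) ?_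
    filter_upwards [Ioo_mem_nhdsGT hdist] with d hd
    have hd0 : 0 < d := (norm_nonneg _).trans_lt hd.1
    have h2d : 2 * d < 1 / ((k : ℝ) + 1) := by
      have := hd.2
      rw [lt_div_iff₀ (by positivity)] at this ⊢
      linarith
    obtain ⟨hK, hum⟩ := hG₁ (2 * d) (by linarith) h2d
    exact hc₁.norm_sub_le hc₂ hd0 hd.1.le (ball_subset_closedBall.trans hK) k.cast_nonneg
      (fun y hy => ha y (ball_subset_ball h2d.le hy)) hum
  · rintro _ ⟨a, ha, rfl⟩
    exact ha.1

end Contact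

/-- If `u` exceeds `φ` at a point of the compact set `K` but lies below `φ` off the interior of
`K`, then all small slopes occur at contact points in the interior of `K`. -/
lemma exists_forall_mem_ball_isContact {V : Type*} [NormedAddCommGroup V] [InnerProductSpace ℝ V]
    {u : V → EReal} {φ : V → ℝ} {K : Set V} (hK : IsCompact K) (hu : UpperSemicontinuousOn u K)
    (hut : ∀ x ∈ K, u x < ⊤) (hφ : Continuous φ) {x₀ : V} (hx₀ : x₀ ∈ K) (hφx₀ : φ x₀ < u x₀)
    (hbd : ∀ x ∈ K, K ∉ 𝓝 x → u x < φ x) :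
    ∃ η > 0, ∀ p ∈ ball (0 : V) η, ∃ x, K ∈ 𝓝 x ∧ IsContact u φ K x p := by
  obtain ⟨c, hc⟩ : ∃ c : ℝ, u x₀ = c :=
    ⟨(u x₀).toReal, (EReal.coe_toReal (hut x₀ hx₀).ne (ne_bot_of_gt hφx₀)).symm⟩
  rw [hc, EReal.coe_lt_coe_iff] at hφx₀
  obtain ⟨D, hD⟩ := hK.isBounded.subset_closedBall x₀
  have hD0 : 0 ≤ D := dist_nonneg.trans (mem_closedBall.1 (hD hx₀))
  refine ⟨(c - φ x₀) / (D + 1), by have := sub_pos.2 hφx₀; positivity, fun p hp => ?_⟩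
  rw [mem_ball_zero_iff, lt_div_iff₀ (by positivity)] at hp
  let f : V → ℝ := fun z => -φ z - inner ℝ p (z - x₀)
  have hf : Continuous f := by fun_prop
  have husc : UpperSemicontinuousOn (fun z => u z + (f z : EReal)) K :=
    hu.add' ((continuous_coe_real_ereal.comp hf).upperSemicontinuous.upperSemicontinuousOn K)
      fun x _ => EReal.continuousAt_add (Or.inr (EReal.coe_ne_bot _)) (Or.inr (EReal.coe_ne_top _))
  obtain ⟨x, hxK, hx⟩ := husc.exists_isMaxOn ⟨x₀, hx₀⟩ hK
  have hx0 : ((c - φ x₀ : ℝ) : EReal) ≤ u x + f x := by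
    refine le_trans (le_of_eq ?_) (hx hx₀)
    simp only [hc, f, sub_self, inner_zero_right, sub_zero, ← EReal.coe_add]
    rw [sub_eq_add_neg]
  obtain ⟨t, ht⟩ : ∃ t : ℝ, u x = t := by
    refine ⟨(u x).toReal, (EReal.coe_toReal (hut x hxK).ne fun h => ?_).symm⟩
    rw [h, EReal.bot_add, le_bot_iff] at hx0
    exact EReal.coe_ne_bot _ hx0
  rw [ht, ← EReal.coe_add, EReal.coe_le_coe_iff] at hx0
  refine ⟨x, ?_, t, ht, fun y hy => ?_⟩
  · by_contra hxn
    have h1 := hbd x hxK hxn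
    rw [ht, EReal.coe_lt_coe_iff] at h1
    have h2 := (abs_le.1 (abs_real_inner_le_norm p (x - x₀))).1
    have h3 : ‖x - x₀‖ ≤ D := mem_closedBall_iff_norm.1 (hD hxK)
    have h4 : ‖p‖ * ‖x - x₀‖ ≤ ‖p‖ * (D + 1) := by gcongr; linarith
    simp only [f] at hx0
    linarith
  · have hy' : u y + f y ≤ u x + f x := hx hy
    rw [ht, ← EReal.coe_add] at hy'
    have h5 := (EReal.le_sub_iff_add_le (Or.inl (EReal.coe_ne_bot _)) (Or.inl (EReal.coe_ne_top _))).2 hy'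
    refine h5.trans ?_
    rw [← EReal.coe_sub, EReal.coe_le_coe_iff]
    have e : inner ℝ p (y - x) = inner ℝ p (y - x₀) - inner ℝ p (x - x₀) := by
      rw [← inner_sub_right, sub_sub_sub_cancel_right]
    simp only [f, e]
    linarith

open Polynomial in
lemma setIntegral_ball_polynomial_re (p : ℂ[X]) (x : ℂ) (r : ℝ) :
    ∫ w in ball x r, (p.eval w).re = (p.eval x).re * volume.real (ball x r) := by
  have h : ∀ q : ℂ[X], (q.eval x).re * volume.real (ball x r) ≤ ∫ w in ball x r, (q.eval w).re :=
    fun q => mul_volume_ball_le_setIntegral_of_le_circleAverage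
      (Complex.continuous_re.comp q.continuous)
      fun s _ => (circleAverage_polynomial_re q x s).ge
  refine le_antisymm ?_ (h p)
  have := h (-p)
  simp only [eval_neg, Complex.neg_re, integral_neg, neg_mul] at this
  linarith

open Polynomial in
/-- A strictly superharmonic upper barrier violates the sub-mean value inequality. -/
lemma not_le_erealBallAvg_of_le {v : ℂ → EReal} {t ε r : ℝ} (p : ℂ[X]) (l : ℂ →L[ℝ] ℝ)
    (hr : 0 < r) (hε : 0 < ε) (ht : v 0 = t)
    (h : ∀ w ∈ ball (0 : ℂ) r,
      v w ≤ ((t + ((p.eval w).re - (p.eval 0).re) + l w - ε * ‖w‖ ^ 2 : ℝ) : EReal)) :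
    ¬ v 0 ≤ erealBallAvg v 0 r := by
  intro hv
  have hpos : volume (ball (0 : ℂ) r) ≠ 0 := (measure_ball_pos volume 0 hr).ne'
  have hfin : volume (ball (0 : ℂ) r) ≠ ⊤ := measure_ball_lt_top.ne
  have hint : ∀ f : ℂ → ℝ, Continuous f → IntegrableOn f (ball 0 r) := fun f hf =>
    (hf.continuousOn.integrableOn_compact (isCompact_closedBall 0 r)).mono_set
      ball_subset_closedBall
  have hp : Continuous fun w : ℂ => (p.eval w).re := Complex.continuous_re.comp p.continuous
  have h1 := le_setAverage_of_le_erealBallAvg (hint _ (by fun_prop)) hpos h (ht ▸ hv)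
  have hl := setIntegral_ball_eq_zero_of_odd (fun y => map_neg l y) 0 r
  simp only [sub_zero] at hl
  have hsq : 0 < ∫ w in ball (0 : ℂ) r, ‖w‖ ^ 2 := by
    rw [setIntegral_pos_iff_support_of_nonneg_ae (ae_of_all _ fun w => by positivity)
      (hint _ (by fun_prop))]
    refine IsOpen.measure_pos _ ?_ ⟨(r / 2 : ℝ), ?_, ?_⟩
    · exact ((continuous_norm.pow 2).isOpen_support).inter isOpen_ball
    · simp [hr.ne']
    · rw [mem_ball_zero_iff, Complex.norm_real, Real.norm_of_nonneg (by linarith)]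
      linarith
  have hvol : 0 < volume.real (ball (0 : ℂ) r) := ENNReal.toReal_pos hpos hfin
  rw [setAverage_eq, integral_sub (hint _ (by fun_prop)) (hint _ (by fun_prop)),
    integral_add (hint _ (by fun_prop)) (hint _ (by fun_prop)),
    integral_add (hint _ (by fun_prop)) (hint _ (by fun_prop)),
    integral_sub (hint _ (by fun_prop)) (hint _ (by fun_prop)), hl,
    setIntegral_ball_polynomial_re, setIntegral_const, setIntegral_const, integral_const_mul,
    smul_eq_mul, smul_eq_mul, smul_eq_mul, ← div_eq_inv_mul, le_div_iff₀ hvol] at h1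
  nlinarith [mul_pos hε hsq]

open Polynomial in
/-- The barrier attached to a polynomial: harmonic minus a strictly convex term along the fibres
`w ↦ z + w • b` with `P b = 1`, and convex of size `C` in the transversal direction. -/
def barrier {H : Type*} [NormedAddCommGroup H] [NormedSpace ℂ H] (P : H →L[ℂ] ℂ) (a b : H)
    (p : ℂ[X]) (w₀ : ℂ) (ε C : ℝ) (z : H) : ℝ :=
  (p.eval (P (z - a))).re - ε * ‖P (z - a) - w₀‖ ^ 2 + C * ‖z - a - P (z - a) • b‖ ^ 2

open Polynomial in
lemma contDiff_barrier {n : ℕ} (P : EuclideanSpace ℂ (Fin n) →L[ℂ] ℂ)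
    (a b : EuclideanSpace ℂ (Fin n)) (p : ℂ[X]) (w₀ : ℂ) (ε C : ℝ) :
    ContDiff ℝ 2 (barrier P a b p w₀ ε C) := by
  have hP : ContDiff ℝ 2 fun z => P (z - a) :=
    (P.restrictScalars ℝ).contDiff.comp (contDiff_id.sub contDiff_const)
  have hp : ContDiff ℝ 2 fun w : ℂ => p.eval w := by
    have : ContDiff ℂ 2 fun w : ℂ => p.eval w := by
      simpa [Polynomial.aeval_def] using p.contDiff_aeval (𝕜 := ℂ) 2
    exact this.restrict_scalars ℝ
  have hre : ContDiff ℝ 2 fun z => (p.eval (P (z - a))).re :=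
    Complex.reCLM.contDiff.comp (hp.comp hP)
  refine (hre.sub (contDiff_const.mul ((hP.sub contDiff_const).norm_sq ℝ))).add
    (contDiff_const.mul (ContDiff.norm_sq ℝ ?_))
  exact (contDiff_id.sub contDiff_const).sub (hP.smul contDiff_const)

open Polynomial in
lemma exists_isCompact_barrier {n : ℕ} {Ω : Set (EuclideanSpace ℂ (Fin n))}
    {u : EuclideanSpace ℂ (Fin n) → EReal} (hΩ : IsOpen Ω) (hu : UpperSemicontinuousOn u Ω)
    (hut : ∀ z ∈ Ω, u z < ⊤) {P : EuclideanSpace ℂ (Fin n) →L[ℂ] ℂ}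
    {a b : EuclideanSpace ℂ (Fin n)} (hPb : P b = 1) {p : ℂ[X]} {w₀ : ℂ} {s ε : ℝ} (hs : 0 < s)
    (hline : ∀ w ∈ closedBall w₀ s, a + w • b ∈ Ω)
    (hsphere : ∀ w ∈ sphere w₀ s,
      u (a + w • b) < (((p.eval w).re - ε * s ^ 2 : ℝ) : EReal)) :
    ∃ (K : Set (EuclideanSpace ℂ (Fin n))) (C : ℝ), IsCompact K ∧ K ⊆ Ω ∧ a + w₀ • b ∈ K ∧
      ∀ z ∈ K, K ∉ 𝓝 z → u z < barrier P a b p w₀ ε C z := by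
  have hQ : ∀ w : ℂ, P (a + w • b - a) = w := fun w => by simp [hPb]
  have hcont : ∀ C, Continuous (barrier P a b p w₀ ε C) := fun C =>
    (contDiff_barrier P a b p w₀ ε C).continuous
  have hlc : Continuous fun w : ℂ => a + w • b := by fun_prop
  have hA : IsCompact ((fun w : ℂ => a + w • b) '' closedBall w₀ s) :=
    (isCompact_closedBall w₀ s).image hlc
  have hA' : IsCompact ((fun w : ℂ => a + w • b) '' sphere w₀ s) :=
    (isCompact_sphere w₀ s).image hlc
  obtain ⟨δ₁, hδ₁, hsub₁⟩ := hA.exists_cthickening_subset_open hΩ (by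
    rintro _ ⟨w, hw, rfl⟩; exact hline w hw)
  obtain ⟨δ₂, hδ₂, hsub₂⟩ := hA'.exists_cthickening_subset_open
    (isOpen_interior (s := {z | u z < barrier P a b p w₀ ε 0 z})) (by
    rintro _ ⟨w, hw, rfl⟩
    rw [mem_interior_iff_mem_nhds]
    have hw' : ‖w - w₀‖ = s := mem_sphere_iff_norm.1 hw
    have hlt : u (a + w • b) < (barrier P a b p w₀ ε 0 (a + w • b) : EReal) := by
      have := hsphere w hw
      simpa only [barrier, hQ, hw', zero_mul, add_zero] using this
    obtain ⟨m, hm₁, hm₂⟩ := EReal.lt_iff_exists_real_btwn.1 hlt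
    have hz : a + w • b ∈ Ω := hline w (sphere_subset_closedBall hw)
    have h1 := hu _ hz _ hm₁
    rw [hΩ.nhdsWithin_eq hz] at h1
    have h2 := (hcont 0).continuousAt.eventually_const_lt (EReal.coe_lt_coe_iff.1 hm₂)
    filter_upwards [h1, h2] with z hz₁ hz₂
    exact hz₁.trans (EReal.coe_lt_coe_iff.2 hz₂))
  set δ := min δ₁ δ₂ with hδ
  have hδ0 : 0 < δ := lt_min hδ₁ hδ₂
  set K : Set (EuclideanSpace ℂ (Fin n)) :=
    {z | ‖P (z - a) - w₀‖ ≤ s ∧ ‖z - a - P (z - a) • b‖ ≤ δ} with hKdef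
  have hdist : ∀ z, dist z (a + P (z - a) • b) = ‖z - a - P (z - a) • b‖ := fun z => by
    rw [dist_eq_norm, sub_add_eq_sub_sub]
  have hKA : K ⊆ cthickening δ ((fun w : ℂ => a + w • b) '' closedBall w₀ s) := fun z hz =>
    mem_cthickening_of_dist_le z _ δ _
      (mem_image_of_mem _ (mem_closedBall_iff_norm.2 hz.1)) ((hdist z).trans_le hz.2)
  have hc₁ : Continuous fun z => ‖P (z - a) - w₀‖ := by fun_prop
  have hc₂ : Continuous fun z => ‖z - a - P (z - a) • b‖ := by fun_prop
  have hKclosed : IsClosed K :=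
    (isClosed_le hc₁ continuous_const).and (isClosed_le hc₂ continuous_const)
  have hKc : IsCompact K := hA.cthickening.of_isClosed_subset hKclosed hKA
  have hKΩ : K ⊆ Ω := hKA.trans ((cthickening_mono (min_le_left _ _) _).trans hsub₁)
  have hx₀ : a + w₀ • b ∈ K := by
    refine ⟨?_, ?_⟩
    · rw [hQ, sub_self, norm_zero]
      exact hs.le
    · rw [hQ, add_sub_cancel_left, sub_self, norm_zero]
      exact hδ0.le
  obtain ⟨zM, hzM, hM⟩ := (hu.mono hKΩ).exists_isMaxOn ⟨_, hx₀⟩ hKc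
  obtain ⟨M, hMlt, -⟩ := EReal.lt_iff_exists_real_btwn.1 (hut zM (hKΩ hzM))
  obtain ⟨zm, hzm, hm⟩ := hKc.exists_isMinOn ⟨_, hx₀⟩ (hcont 0).continuousOn
  set m := barrier P a b p w₀ ε 0 zm with hmdef
  have hC : ∀ C z, barrier P a b p w₀ ε C z =
      barrier P a b p w₀ ε 0 z + C * ‖z - a - P (z - a) • b‖ ^ 2 := fun C z => by
    simp only [barrier, zero_mul, add_zero]
  refine ⟨K, |M - m| / δ ^ 2, hKc, hKΩ, hx₀, fun z hz hzn => ?_⟩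
  have hor : ‖P (z - a) - w₀‖ = s ∨ ‖z - a - P (z - a) • b‖ = δ := by
    by_contra! hne
    refine hzn (mem_of_superset (IsOpen.mem_nhds (s := {z | ‖P (z - a) - w₀‖ < s ∧
      ‖z - a - P (z - a) • b‖ < δ}) ?_ ⟨hz.1.lt_of_ne hne.1, hz.2.lt_of_ne hne.2⟩) ?_)
    · exact (isOpen_lt hc₁ continuous_const).and (isOpen_lt hc₂ continuous_const)
    · exact fun y hy => ⟨hy.1.le, hy.2.le⟩
  rw [hC]
  rcases hor with h | h
  · have hz' : z ∈ cthickening δ₂ ((fun w : ℂ => a + w • b) '' sphere w₀ s) :=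
      mem_cthickening_of_dist_le z _ δ₂ _ (mem_image_of_mem _ (mem_sphere_iff_norm.2 h))
        ((hdist z).trans_le (hz.2.trans (min_le_right _ _)))
    have h1 : u z < barrier P a b p w₀ ε 0 z :=
      interior_subset (s := {z | u z < barrier P a b p w₀ ε 0 z}) (hsub₂ hz')
    refine h1.trans_le (EReal.coe_le_coe_iff.2 ?_)
    have : 0 ≤ |M - m| / δ ^ 2 * ‖z - a - P (z - a) • b‖ ^ 2 := by positivity
    linarith
  · refine ((hM hz).trans_lt hMlt).trans_le (EReal.coe_le_coe_iff.2 ?_)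
    rw [h, div_mul_cancel₀ _ (by positivity)]
    have h1 : m ≤ barrier P a b p w₀ ε 0 z := hm hz
    linarith [le_abs_self (M - m)]

/-- Theorem (statement 14, removal of singularities): let `Ω ⊆ ℂⁿ` be a domain and `E ⊆ Ω` a
closed subset of `Ω` of Lebesgue measure zero. If `u` is subharmonic on `Ω` (viewing
`Ω ⊆ ℝ²ⁿ`) and plurisubharmonic on `Ω \ E`, then `u` is plurisubharmonic on all of `Ω`. -/
theorem psh_removal_of_singularities (n : ℕ) (Ω : Set (EuclideanSpace ℂ (Fin n)))
    (hopen : IsOpen Ω) (hconn : IsConnected Ω)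
    (Ecl : Set (EuclideanSpace ℂ (Fin n))) (hEsub : Ecl ⊆ Ω)
    (hEclosed : IsOpen (Ω \ Ecl)) (hEnull : volume Ecl = 0)
    (u : EuclideanSpace ℂ (Fin n) → EReal)
    (hsub : IsSubharmonicOn u Ω)
    (hpsh : IsPlurisubharmonicOn u (Ω \ Ecl)) :
    IsPlurisubharmonicOn u Ω := by
  obtain ⟨hu, hbot, hut, hmean⟩ := hsub
  refine ⟨hu, hbot, hut, fun a b w₀ hw₀ => ⟨1, one_pos, fun r hr _ hrΩ => ?_⟩⟩
  by_contra! hlt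
  have hlc : Continuous fun w : ℂ => a + w • b := by fun_prop
  obtain ⟨c, hc⟩ : ∃ c : ℝ, u (a + w₀ • b) = c :=
    ⟨_, (EReal.coe_toReal (hut _ hw₀).ne (ne_bot_of_gt hlt)).symm⟩
  rw [hc] at hlt
  have hvusc : UpperSemicontinuousOn (fun w : ℂ => u (a + w • b)) (closedBall w₀ r) :=
    fun w hw m hm => (hlc.continuousWithinAt.tendsto_nhdsWithin hrΩ).eventually
      (hu _ (hrΩ hw) m hm)
  obtain ⟨s, ε, p, hs, hsr, hε, hpc, hsphere⟩ :=
    exists_polynomial_of_erealBallAvg_lt hr hvusc (fun w hw => hut _ (hrΩ hw)) hlt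
  have hb : b ≠ 0 := by
    rintro rfl
    simp only [smul_zero] at hlt hc
    rw [hc, erealBallAvg_coe (f := fun _ : ℂ => c) (integrableOn_const measure_ball_lt_top.ne)
      (measure_ball_pos volume w₀ hr).ne', setAverage_const
      (measure_ball_pos volume w₀ hr).ne' measure_ball_lt_top.ne] at hlt
    exact lt_irrefl _ hlt
  obtain ⟨P, hPb⟩ := SeparatingDual.exists_eq_one (R := ℂ) hb
  have hline : ∀ w ∈ closedBall w₀ s, a + w • b ∈ Ω := fun w hw =>
    hrΩ (closedBall_subset_closedBall hsr.le hw)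
  obtain ⟨K, C, hK, hKΩ, hx₀K, hbd⟩ := exists_isCompact_barrier hopen hu hut hPb hs hline hsphere
  set φ := barrier P a b p w₀ ε C with hφ
  have hφ2 : ContDiff ℝ 2 φ := contDiff_barrier P a b p w₀ ε C
  have hφx₀ : (φ (a + w₀ • b) : EReal) < u (a + w₀ • b) := by
    rw [hc, EReal.coe_lt_coe_iff]
    simpa [hφ, barrier, hPb] using hpc
  obtain ⟨η, hη, hcontact⟩ := exists_forall_mem_ball_isContact hK (hu.mono hKΩ)
    (fun x hx => hut x (hKΩ hx)) hφ2.continuous hx₀K hφx₀ hbd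
  obtain ⟨q, x, hxK, ⟨t, ht, hx⟩, hxE⟩ := exists_isContact_notMem_of_measure_eq_zero hmean hφ2 hKΩ
    hEnull (measure_ball_pos volume 0 hη).ne' hcontact
  have hxΩ : x ∈ Ω \ Ecl := ⟨hKΩ (mem_of_mem_nhds hxK), hxE⟩
  have hlx : Continuous fun w : ℂ => x + w • b := by fun_prop
  obtain ⟨R, hR, hRmean⟩ := hpsh.2.2.2 x b 0 (by simpa using hxΩ)
  obtain ⟨ρ, hρ, hρsub⟩ : ∃ ρ > 0,
      ball (0 : ℂ) ρ ⊆ (fun w : ℂ => x + w • b) ⁻¹' (K ∩ (Ω \ Ecl)) :=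
    Metric.mem_nhds_iff.1 (hlx.continuousAt.preimage_mem_nhds
      (by simpa using inter_mem hxK (hEclosed.mem_nhds hxΩ)))
  set d := min R ρ / 2 with hd
  have hd0 : 0 < d := half_pos (lt_min hR hρ)
  have hdR : d < R := (half_lt_self (lt_min hR hρ)).trans_le (min_le_left _ _)
  have hdρ : d < ρ := (half_lt_self (lt_min hR hρ)).trans_le (min_le_right _ _)
  have hdsub : closedBall (0 : ℂ) d ⊆ (fun w : ℂ => x + w • b) ⁻¹' (K ∩ (Ω \ Ecl)) :=
    (closedBall_subset_ball hdρ).trans hρsub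
  let l : ℂ →L[ℝ] ℝ := (innerSL ℝ q).comp
    ((ContinuousLinearMap.toSpanSingleton ℂ b).restrictScalars ℝ)
    - (2 * ε) • innerSL ℝ (P (x - a) - w₀)
  refine not_le_erealBallAvg_of_le (p.comp (Polynomial.C (P (x - a)) + Polynomial.X)) l hd0 hε
    (v := fun w => u (x + w • b)) (t := t) (by simpa using ht) (fun w hw => ?_)
    (hRmean d hd0 hdR fun w hw => (hdsub hw).2)
  refine (hx _ (hdsub (ball_subset_closedBall hw)).1).trans (EReal.coe_le_coe_iff.2 (le_of_eq ?_))
  have e1 : P (x + w • b - a) = P (x - a) + w := by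
    rw [add_sub_right_comm, map_add, map_smul, hPb, smul_eq_mul, mul_one]
  have e2 : x + w • b - a - (P (x - a) + w) • b = x - a - P (x - a) • b := by
    rw [add_smul]; abel
  have e3 : ‖P (x - a) + w - w₀‖ ^ 2 =
      ‖P (x - a) - w₀‖ ^ 2 + 2 * inner ℝ (P (x - a) - w₀) w + ‖w‖ ^ 2 := by
    rw [add_sub_right_comm, norm_add_sq_real]
  have e4 : l w = inner ℝ q (w • b) - 2 * ε * inner ℝ (P (x - a) - w₀) w := rfl
  simp only [hφ, barrier, e1, e2, e3, e4, add_sub_cancel_left, Polynomial.eval_comp,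
    Polynomial.eval_add, Polynomial.eval_C, Polynomial.eval_X, add_zero]
  ring

end
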